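/- Let h be the valuation on words over {a,b} with h(a) = 3 and h(b) = −2, extended additively, and let U_{3/2} be the set of all nonempty factor-free words w with h(w) = 0, having at least one prefix with negative valuation, and satisfying h(w₁) > −2 for every prefix w₁ of w. Then for every n ≥ 1, the number of words in U_{3/2} of length 5n equals the n-th Catalan number C_n = C(2n, n)/(n+1). -/

import Mathlib

/-- The valuation of a word over {a,b} with h(a) = 3, h(b) = −2 (slope 3/2),
extended additively. The letter `a` is encoded by `true` and `b` by `false`. -/
def wordVal (w : List Bool) : ℤ :=
  (w.map (fun c => if c then (3 : ℤ) else -2)).sum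

/-- A generalized Dyck word: total valuation 0 and every prefix has valuation ≥ 0. -/
def IsDyck (w : List Bool) : Prop :=
  wordVal w = 0 ∧ ∀ p : List Bool, p <+: w → 0 ≤ wordVal p

/-- A word is factor-free if no nonempty proper factor of it is a generalized
Dyck word. -/
def FactorFree (w : List Bool) : Prop :=
  ∀ w₁ w' w₂ : List Bool, w = w₁ ++ w' ++ w₂ → w' ≠ [] → ¬(w₁ = [] ∧ w₂ = []) →
    ¬ IsDyck w'

/-- Membership in the auxiliary language U_{3/2}: nonempty factor-free words of total
valuation 0, with some prefix of negative valuation, all prefixes of valuation > −2. -/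
def MemU32 (w : List Bool) : Prop :=
  w ≠ [] ∧ FactorFree w ∧ wordVal w = 0 ∧
    (∃ p : List Bool, p <+: w ∧ wordVal p < 0) ∧
    (∀ p : List Bool, p <+: w → -2 < wordVal p)

theorem wordVal_nil : wordVal [] = 0 := rfl

theorem wordVal_cons (c : Bool) (w : List Bool) :
    wordVal (c :: w) = (if c then 3 else -2) + wordVal w := by
  simp [wordVal]

theorem wordVal_append (u v : List Bool) : wordVal (u ++ v) = wordVal u + wordVal v := by
  simp [wordVal]

/-- All prefixes of `w` have valuation at least `k`. -/
def PrefixBound (k : ℤ) (w : List Bool) : Prop :=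
  ∀ p : List Bool, p <+: w → k ≤ wordVal p

/-- No nonempty factor of `w`, including `w` itself, is a generalized Dyck word. -/
def DyckFree (w : List Bool) : Prop :=
  ∀ t : List Bool, t <:+: w → t ≠ [] → ¬ IsDyck t

/-- The words of `U_{3/2}` together with the empty word. -/
structure MemV32 (w : List Bool) : Prop where
  dyckFree : DyckFree w
  val_eq : wordVal w = 0
  bound : PrefixBound (-1) w

theorem memU32_iff (w : List Bool) : MemU32 w ↔ w ≠ [] ∧ MemV32 w := by
  constructor
  · rintro ⟨hne, hff, hv, ⟨p, hp, hpn⟩, hb⟩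
    refine ⟨hne, ?_, hv, fun p hp => by have := hb p hp; omega⟩
    rintro t ⟨u, v, rfl⟩ ht hd
    by_cases h : u = [] ∧ v = []
    · obtain ⟨rfl, rfl⟩ := h
      have := hd.2 p (by simpa using hp)
      omega
    · exact hff u t v rfl ht h hd
  · rintro ⟨hne, hdf, hv, hb⟩
    refine ⟨hne, ?_, hv, ?_, fun p hp => by have := hb p hp; omega⟩
    · rintro u t v rfl ht _ hd
      exact hdf t ⟨u, v, rfl⟩ ht hd
    · by_contra! h
      exact hdf w (List.infix_refl w) hne ⟨hv, h⟩

theorem DyckFree.of_infix {u w : List Bool} (hw : DyckFree w) (h : u <:+: w) : DyckFree u :=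
  fun t ht => hw t (ht.trans h)

theorem DyckFree.cons {c : Bool} {w : List Bool} (hw : DyckFree w)
    (h : ∀ p, p <+: w → wordVal (c :: p) ≠ 0) : DyckFree (c :: w) := by
  intro t ht hne hd
  rcases List.infix_cons_iff.1 ht with ht | ht
  · rcases List.prefix_cons_iff.1 ht with rfl | ⟨p, rfl, hp⟩
    · exact hne rfl
    · exact h p hp hd.1
  · exact hw t ht hne hd

theorem DyckFree.concat {c : Bool} {w : List Bool} (hw : DyckFree w)
    (h : ∀ p, p <+: w → wordVal p ≠ wordVal (w ++ [c])) : DyckFree (w ++ [c]) := by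
  intro t ht hne hd
  rcases List.infix_concat_iff.1 ht with ⟨p, hp⟩ | ht
  · have hv : wordVal p = wordVal (w ++ [c]) := by
      rw [← hp, wordVal_append, hd.1, add_zero]
    rcases List.prefix_concat_iff.1 ⟨t, hp⟩ with rfl | hpw
    · exact hne (by simpa using hp)
    · exact h p hpw hv
  · exact hw t ht hne hd

theorem DyckFree.append {u v : List Bool} (hu : DyckFree u) (hv : DyckFree v)
    (h : ∀ s, s <:+ u → s ≠ [] → wordVal s < 0) : DyckFree (u ++ v) := by
  rintro t ⟨l, r, hlr⟩ hne hd
  rw [List.append_assoc] at hlr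
  rcases List.append_eq_append_iff.1 hlr with ⟨s, rfl, hs⟩ | ⟨s, rfl, hs⟩
  · rcases List.append_eq_append_iff.1 hs with ⟨q, rfl, rfl⟩ | ⟨q, rfl, rfl⟩
    · exact hu t ⟨l, q, by simp⟩ hne hd
    · by_cases hs0 : s = []
      · subst hs0
        exact hv q ⟨[], r, by simp⟩ (by simpa using hne) (by simpa using hd)
      · have h₁ := h s ⟨l, rfl⟩ hs0
        have h₂ := hd.2 s ⟨q, rfl⟩
        omega
  · exact hv t ⟨s, r, by rw [hs, List.append_assoc]⟩ hne hd

theorem DyckFree.val_ne_zero {u t v : List Bool} (hw : DyckFree (u ++ t ++ v)) (ht : t ≠ [])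
    (hb : PrefixBound (wordVal u) (u ++ t) ∨ PrefixBound 0 t) : wordVal t ≠ 0 := by
  intro h0
  refine hw t ⟨u, v, rfl⟩ ht ⟨h0, fun p hp => ?_⟩
  rcases hb with hb | hb
  · have := hb (u ++ p) (by simpa using hp)
    rw [wordVal_append] at this
    omega
  · exact hb p hp

/-- The word of `U_{3/2}` built from two smaller ones, either of which may be empty. -/
def joinWords (x y : List Bool) : List Bool :=
  (true :: x ++ [false] ++ [false]) ++ (true :: y ++ [false])

theorem val_of_prefix_cons {k : ℤ} {x p : List Bool} (hx : PrefixBound k x)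
    (hp : p <+: true :: x) : p = [] ∨ 3 + k ≤ wordVal p := by
  rcases List.prefix_cons_iff.1 hp with rfl | ⟨q, rfl, hq⟩
  · exact Or.inl rfl
  · have := hx q hq
    right
    simp only [wordVal_cons, if_true]
    omega

theorem val_join_left {x : List Bool} (hx : wordVal x = 0) :
    wordVal (true :: x ++ [false]) = 1 := by
  simp [wordVal_cons, wordVal_append, wordVal_nil, hx]

theorem MemV32.dyckFree_join_left {x : List Bool} (hx : MemV32 x) :
    DyckFree (true :: x ++ [false]) := by
  refine (hx.dyckFree.cons fun p hp => ?_).concat fun p hp => ?_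
  · have := hx.bound p hp
    simp only [wordVal_cons, if_true]
    omega
  · rw [val_join_left hx.val_eq]
    rcases val_of_prefix_cons hx.bound hp with rfl | h
    · simp [wordVal_nil]
    · omega

theorem MemV32.bound_join_left {x : List Bool} (hx : MemV32 x) :
    PrefixBound 0 (true :: x ++ [false]) := by
  intro p hp
  rcases List.prefix_concat_iff.1 hp with rfl | hp
  · rw [val_join_left hx.val_eq]
    omega
  · rcases val_of_prefix_cons hx.bound hp with rfl | h
    · simp [wordVal_nil]
    · omega

theorem MemV32.join {x y : List Bool} (hx : MemV32 x) (hy : MemV32 y) :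
    MemV32 (joinWords x y) := by
  have hl : wordVal (true :: x ++ [false] ++ [false]) = -1 := by
    rw [wordVal_append, val_join_left hx.val_eq]
    rfl
  have hr := val_join_left hy.val_eq
  refine ⟨?_, ?_, ?_⟩
  · refine (hx.dyckFree_join_left.concat fun p hp => ?_).append hy.dyckFree_join_left ?_
    · have := hx.bound_join_left p hp
      omega
    · rintro s ⟨p, hp⟩ hs
      rcases List.prefix_concat_iff.1 ⟨s, hp⟩ with rfl | hp'
      · exact absurd (by simpa using hp) hs
      · have h₁ := hx.bound_join_left p hp'
        rw [← hp, wordVal_append] at hl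
        omega
  · rw [joinWords, wordVal_append, hl, hr]
    rfl
  · intro p hp
    obtain ⟨r, hr⟩ := hp
    rcases List.append_eq_append_iff.1 hr with ⟨q, hq, -⟩ | ⟨q, rfl, hq⟩
    · have hp : p <+: true :: x ++ [false] ++ [false] := ⟨q, hq.symm⟩
      rcases List.prefix_concat_iff.1 hp with rfl | hp
      · omega
      · have := hx.bound_join_left p hp
        omega
    · have := hy.bound_join_left q ⟨r, hq.symm⟩
      rw [wordVal_append]
      omega

theorem left_prefix_eq {x x' c : List Bool} (hx : wordVal x = 0) (hx' : MemV32 x')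
    (h : true :: x' ++ [false] ++ [false] = true :: x ++ [false] ++ [false] ++ c) : c = [] := by
  have hl : wordVal (true :: x ++ [false] ++ [false]) = -1 := by
    rw [wordVal_append, val_join_left hx]
    rfl
  rcases List.prefix_concat_iff.1 ⟨c, h.symm⟩ with h' | h'
  · rw [h'] at h
    simpa using h
  · have := hx'.bound_join_left _ h'
    omega

theorem joinWords_inj {x y x' y' : List Bool} (hx : MemV32 x) (hx' : MemV32 x')
    (h : joinWords x y = joinWords x' y') : x = x' ∧ y = y' := by
  rcases List.append_eq_append_iff.1 h with ⟨c, h₁, h₂⟩ | ⟨c, h₁, h₂⟩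
  · obtain rfl := left_prefix_eq hx.val_eq hx' h₁
    simp_all
  · obtain rfl := left_prefix_eq hx'.val_eq hx h₁
    simp_all

theorem exists_left {p : List Bool} (hd : DyckFree p) (hv : wordVal p = -1)
    (hb : PrefixBound (-1) p) : ∃ x, MemV32 x ∧ p = true :: x ++ [false] ++ [false] := by
  obtain ⟨x, hx0, rfl⟩ : ∃ x, wordVal x = 0 ∧ p = true :: x ++ [false] ++ [false] := by
    rcases p with _ | ⟨_ | _, p⟩
    · simp [wordVal_nil] at hv
    · have := hb [false] (by simp)
      simp [wordVal_cons, wordVal_nil] at this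
    · rcases List.eq_nil_or_concat p with rfl | ⟨r, c, rfl⟩
      · simp [wordVal_cons, wordVal_nil] at hv
      · have h₁ := hb (true :: r) (by simp)
        rcases List.eq_nil_or_concat r with rfl | ⟨x, d, rfl⟩
        · cases c <;> simp [wordVal_cons, wordVal_nil] at hv
        · have h₂ := hb (true :: x) (by simp)
          refine ⟨x, ?_, ?_⟩ <;> cases c <;> cases d <;>
            simp [wordVal_cons, wordVal_nil, wordVal_append] at hv h₁ h₂ ⊢ <;> omega
  have h1 : ∀ s, s <+: true :: x ++ [false] → wordVal s ≠ -1 := by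
    rintro s ⟨t, ht⟩ hs
    rw [← ht, List.append_assoc] at hd hv hb
    refine DyckFree.val_ne_zero (v := []) (by simpa using hd) (by simp) (Or.inl (by rwa [hs])) ?_
    rw [wordVal_append] at hv
    omega
  have h0 : ∀ s, s <+: true :: x ++ [false] → s ≠ [] → wordVal s ≠ 0 := by
    intro s hs hne
    have hs' : s <+: true :: x ++ [false] ++ [false] := hs.trans (List.prefix_append _ _)
    obtain ⟨t, ht⟩ := hs'
    refine DyckFree.val_ne_zero (u := []) (v := t) (by simpa [ht] using hd) hne
      (Or.inr fun q hq => ?_)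
    have := h1 q (hq.trans hs)
    have := hb q ((hq.trans hs).trans (List.prefix_append _ _))
    omega
  have hpos : ∀ s, s <+: true :: x ++ [false] → s ≠ [] → 1 ≤ wordVal s := by
    intro s hs hne
    have := h1 s hs
    have := h0 s hs hne
    have := hb s (hs.trans (List.prefix_append _ _))
    omega
  refine ⟨x, ⟨hd.of_infix ⟨[true], [false, false], by simp⟩, hx0, ?_⟩, rfl⟩
  rintro s ⟨t, rfl⟩
  have hs := hpos (true :: s) (by simp) (by simp)
  by_contra hlt
  have hs1 : wordVal s = -2 := by
    simp only [wordVal_cons, if_true] at hs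
    omega
  refine DyckFree.val_ne_zero (u := true :: s) (t := t ++ [false]) (v := [false])
    (by simpa using hd) (by simp) (Or.inr fun q hq => ?_) ?_
  · have := hpos (true :: s ++ q) (by simpa using hq) (by simp)
    simp only [wordVal_cons, wordVal_append, if_true, List.cons_append] at this
    omega
  · simp [wordVal_append, wordVal_cons, wordVal_nil] at hx0 ⊢
    omega

theorem exists_right {p : List Bool} (hd : DyckFree p) (hv : wordVal p = 1)
    (hb : PrefixBound 0 p) : ∃ x, MemV32 x ∧ p = true :: x ++ [false] := by
  obtain ⟨x, hx0, rfl⟩ : ∃ x, wordVal x = 0 ∧ p = true :: x ++ [false] := by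
    rcases p with _ | ⟨_ | _, p⟩
    · simp [wordVal_nil] at hv
    · have := hb [false] (by simp)
      simp [wordVal_cons, wordVal_nil] at this
    · rcases List.eq_nil_or_concat p with rfl | ⟨x, c, rfl⟩
      · simp [wordVal_cons, wordVal_nil] at hv
      · have h₁ := hb (true :: x) (by simp)
        refine ⟨x, ?_, ?_⟩ <;> cases c <;>
          simp [wordVal_cons, wordVal_nil, wordVal_append] at hv h₁ ⊢ <;> omega
  have hpos : ∀ s, s <+: true :: x ++ [false] → s ≠ [] → 1 ≤ wordVal s := by
    intro s hs hne
    have h0 := hb s hs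
    obtain ⟨t, ht⟩ := hs
    have := DyckFree.val_ne_zero (u := []) (v := t) (by simpa [ht] using hd) hne
      (Or.inr fun q hq => hb q (hq.trans ⟨t, ht⟩))
    omega
  refine ⟨x, ⟨hd.of_infix ⟨[true], [false], by simp⟩, hx0, ?_⟩, rfl⟩
  rintro s ⟨t, rfl⟩
  have hs := hpos (true :: s) (by simp) (by simp)
  by_contra hlt
  have hs1 : wordVal s = -2 := by
    simp only [wordVal_cons, if_true] at hs
    omega
  refine DyckFree.val_ne_zero (u := true :: s) (t := t ++ [false]) (v := [])
    (by simpa using hd) (by simp) (Or.inr fun q hq => ?_) ?_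
  · have := hpos (true :: s ++ q) (by simpa using hq) (by simp)
    simp only [wordVal_cons, wordVal_append, if_true, List.cons_append] at this
    omega
  · simp [wordVal_append, wordVal_cons, wordVal_nil] at hx0 ⊢
    omega

theorem MemV32.exists_join {w : List Bool} (hw : MemV32 w) (hne : w ≠ []) :
    ∃ x y, MemV32 x ∧ MemV32 y ∧ w = joinWords x y := by
  obtain ⟨-, -, -, ⟨p, ⟨q, rfl⟩, hp⟩, -⟩ := (memU32_iff w).2 ⟨hne, hw⟩
  have hp1 : wordVal p = -1 := by
    have := hw.bound p (List.prefix_append _ _)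
    omega
  have hv := hw.val_eq
  rw [wordVal_append] at hv
  obtain ⟨x, hx, rfl⟩ := exists_left (hw.dyckFree.of_infix ⟨[], q, rfl⟩) hp1
    fun s hs => hw.bound s (hs.trans (List.prefix_append _ _))
  obtain ⟨y, hy, rfl⟩ := exists_right (hw.dyckFree.of_infix (List.suffix_append _ q).isInfix)
    (by omega : wordVal q = 1) fun s hs => by
      have := hw.bound (_ ++ s) ((List.prefix_append_right_inj _).2 hs)
      rw [wordVal_append] at this
      omega
  exact ⟨x, y, hx, hy, rfl⟩

/-- The word coded by a binary tree. -/
def treeWord : BinaryTree Unit → List Bool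
  | .nil => []
  | .node _ l r => joinWords (treeWord l) (treeWord r)

theorem memV32_treeWord (t : BinaryTree Unit) : MemV32 (treeWord t) := by
  induction t with
  | nil =>
    refine ⟨fun t ht hne => absurd (List.infix_nil.1 ht) hne, rfl, fun p hp => ?_⟩
    rw [List.prefix_nil.1 hp, wordVal_nil]
    omega
  | node _ l r hl hr => exact hl.join hr

theorem length_treeWord (t : BinaryTree Unit) : (treeWord t).length = 5 * t.numNodes := by
  induction t with
  | nil => rfl
  | node _ l r hl hr =>
    simp [treeWord, joinWords, hl, hr]
    omega

theorem treeWord_injective : Function.Injective treeWord := by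
  intro s
  induction s with
  | nil =>
    intro t h
    cases t with
    | nil => rfl
    | node _ l r => simp [treeWord, joinWords] at h
  | node _ l r hl hr =>
    intro t h
    cases t with
    | nil => simp [treeWord, joinWords] at h
    | node _ l' r' =>
      obtain ⟨h₁, h₂⟩ := joinWords_inj (memV32_treeWord l) (memV32_treeWord l') h
      rw [hl h₁, hr h₂]

theorem MemV32.exists_treeWord {w : List Bool} (hw : MemV32 w) : ∃ t, treeWord t = w := by
  induction hn : w.length using Nat.strong_induction_on generalizing w with
  | _ n ih =>
    by_cases hne : w = []
    · exact ⟨.nil, hne.symm⟩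
    · obtain ⟨x, y, hx, hy, rfl⟩ := hw.exists_join hne
      simp only [joinWords, List.length_append, List.length_cons, List.length_nil] at hn
      obtain ⟨s, rfl⟩ := ih x.length (by omega) hx rfl
      obtain ⟨t, rfl⟩ := ih y.length (by omega) hy rfl
      exact ⟨.node () s t, rfl⟩

/-- The number of words of length 5n in U_{3/2} is the n-th Catalan number. -/
theorem stmt18 :
    ∀ n : ℕ, 1 ≤ n →
      (Nat.card {w : List Bool // MemU32 w ∧ w.length = 5 * n} : ℚ)
        = ((2 * n).choose n : ℚ) / (n + 1) := by
  intro n hn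
  have hcard : Nat.card {w : List Bool // MemU32 w ∧ w.length = 5 * n} = catalan n := by
    rw [Nat.subtype_card ((BinaryTree.treesOfNumNodesEq n).image treeWord),
      Finset.card_image_of_injective _ treeWord_injective,
      BinaryTree.treesOfNumNodesEq_card_eq_catalan]
    intro w
    simp only [Finset.mem_image, BinaryTree.mem_treesOfNumNodesEq, memU32_iff]
    constructor
    · rintro ⟨t, rfl, rfl⟩
      refine ⟨⟨fun h => ?_, memV32_treeWord t⟩, length_treeWord t⟩
      have := length_treeWord t
      rw [h, List.length_nil] at this
      omega
    · rintro ⟨⟨-, hw⟩, hlen⟩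
      obtain ⟨t, rfl⟩ := hw.exists_treeWord
      rw [length_treeWord] at hlen
      exact ⟨t, by omega, rfl⟩
  rw [hcard, eq_div_iff (by positivity), ← Nat.centralBinom_eq_two_mul_choose,
    ← succ_mul_catalan_eq_centralBinom]
  push_cast
  ring
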